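/- Let 0 < p < 1, and set α = p³(2+p)/(1+2p) and β = (27/4)·p²(1+p)²/(1+p+p²)³. Then F(1/2, 1/2; 1; 1−α) / F(1/2, 1/2; 1; α) = √3 · F(1/3, 2/3; 1; 1−β) / F(1/3, 2/3; 1; β). -/

import Mathlib

/-- The Gauss hypergeometric series `F(a, b; c; x) = ∑ (a)_n (b)_n / ((c)_n n!) xⁿ`,
where `(q)_n` is the rising Pochhammer symbol. -/
noncomputable def hypF (a b c x : ℝ) : ℝ :=
  ∑' n : ℕ, ((ascPochhammer ℝ n).eval a * (ascPochhammer ℝ n).eval b /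
    ((ascPochhammer ℝ n).eval c * (Nat.factorial n))) * x ^ n

open Set in
/-- A function on `[0, 1)` that is continuous and has zero derivative on `(0, 1)` is constant. -/
lemma eq_left_of_hasDerivAt_zero {V : ℝ → ℝ} (hc : ContinuousOn V (Ico 0 1))
    (hd : ∀ p ∈ Ioo (0 : ℝ) 1, HasDerivAt V 0 p) {p : ℝ} (hp : p ∈ Ioo (0 : ℝ) 1) :
    V p = V 0 := by
  have hsub : Icc 0 p ⊆ Ico (0 : ℝ) 1 := fun x hx => ⟨hx.1, hx.2.trans_lt hp.2⟩
  obtain ⟨c, -, hc'⟩ := exists_hasDerivAt_eq_slope V (fun _ => 0) hp.1 (hc.mono hsub)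
    (fun x hx => hd x ⟨hx.1, hx.2.trans hp.2⟩)
  rw [eq_comm, div_eq_zero_iff] at hc'
  rcases hc' with h | h
  · linarith
  · linarith [hp.1]

open Set in
/-- If `(u, w)` and `(v, z)` solve first-order systems related by the gauge factor `h`, and both
are regular at the singular point `0`, then `v` is proportional to `h * u`. -/
lemma proportional_of_gauge {u w v z h A B A' B' r P Q Q' : ℝ → ℝ} {K : ℝ}
    (hu : ∀ p ∈ Ioo (0 : ℝ) 1, HasDerivAt u (A p * w p) p)
    (hw : ∀ p ∈ Ioo (0 : ℝ) 1, HasDerivAt w (B p * u p) p)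
    (hv : ∀ p ∈ Ioo (0 : ℝ) 1, HasDerivAt v (A' p * z p) p)
    (hz : ∀ p ∈ Ioo (0 : ℝ) 1, HasDerivAt z (B' p * v p) p)
    (hh : ∀ p ∈ Ioo (0 : ℝ) 1, HasDerivAt h (r p * h p) p)
    (hQ : ∀ p ∈ Ioo (0 : ℝ) 1, HasDerivAt Q (Q' p) p)
    (hPA' : ∀ p ∈ Ioo (0 : ℝ) 1, P p * A' p = 1)
    (hPA : ∀ p ∈ Ioo (0 : ℝ) 1, P p * h p ^ 2 * A p = K)
    (hPQ : ∀ p ∈ Ioo (0 : ℝ) 1, Q p = P p * r p)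
    (hB : ∀ p ∈ Ioo (0 : ℝ) 1, (B' p - Q' p - Q p * r p) * h p ^ 2 = K * B p)
    (cu : ContinuousOn u (Ico 0 1)) (cw : ContinuousOn w (Ico 0 1))
    (cv : ContinuousOn v (Ico 0 1)) (cz : ContinuousOn z (Ico 0 1))
    (ch : ContinuousOn h (Ico 0 1)) (cQ : ContinuousOn Q (Ico 0 1))
    (w0 : w 0 = 0) (z0 : z 0 = 0) (Q0 : Q 0 = 0)
    (hpos : ∀ p ∈ Ico (0 : ℝ) 1, 0 < h p) (upos : ∀ p ∈ Ico (0 : ℝ) 1, 0 < u p)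
    {p : ℝ} (hp : p ∈ Ioo (0 : ℝ) 1) :
    v p / (h p * u p) = v 0 / (h 0 * u 0) := by
  have hV : ∀ p ∈ Ioo (0 : ℝ) 1,
      z p * (h p * u p) - K * (v p * w p) / h p - Q p * h p * (v p * u p) = 0 := by
    intro p hp
    have := eq_left_of_hasDerivAt_zero
      (V := fun p => z p * (h p * u p) - K * (v p * w p) / h p - Q p * h p * (v p * u p))
      ?_ ?_ hp
    · simpa [w0, z0, Q0] using this
    · exact ((cz.mul (ch.mul cu)).sub
        ((continuousOn_const.mul (cv.mul cw)).div ch fun x hx => (hpos x hx).ne')).sub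
        ((cQ.mul ch).mul (cv.mul cu))
    · intro x hx
      have hx0 := (hpos x (Ioo_subset_Ico_self hx)).ne'
      refine ((((hz x hx).mul ((hh x hx).mul (hu x hx))).sub
        ((((hv x hx).mul (hw x hx)).const_mul K).div (hh x hx) hx0)).sub
        (((hQ x hx).mul (hh x hx)).mul ((hv x hx).mul (hu x hx)))).congr_deriv ?_
      have e1 := hPA' x hx
      have e2 := hPA x hx
      have e3 := hPQ x hx
      have e4 := hB x hx
      have e5 : h x ^ 2 * A x = K * A' x := by
        linear_combination A' x * e2 - h x ^ 2 * A x * e1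
      simp only [Pi.mul_apply]
      field_simp
      have e6 : Q x * A' x = r x := by rw [e3]; linear_combination r x * e1
      have e7 : Q x * h x ^ 2 * A x = K * r x := by rw [e3]; linear_combination r x * e2
      linear_combination u x * v x * e4 + z x * w x * e5 - h x ^ 2 * z x * u x * e6
        - v x * w x * e7
  refine eq_left_of_hasDerivAt_zero (V := fun p => v p / (h p * u p)) ?_ ?_ hp
  · exact cv.div (ch.mul cu) fun x hx => (mul_pos (hpos x hx) (upos x hx)).ne'
  · intro x hx
    have hx0 := hpos x (Ioo_subset_Ico_self hx)
    have ux0 := upos x (Ioo_subset_Ico_self hx)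
    refine ((hv x hx).div ((hh x hx).mul (hu x hx)) (mul_pos hx0 ux0).ne').congr_deriv ?_
    rw [div_eq_zero_iff]
    left
    have e0 := hV x hx
    have e1 := hPA' x hx
    have e2 := hPA x hx
    have e3 := hPQ x hx
    have e5 : h x ^ 2 * A x = K * A' x := by
      linear_combination A' x * e2 - h x ^ 2 * A x * e1
    have e6 : Q x * A' x = r x := by rw [e3]; linear_combination r x * e1
    simp only [Pi.mul_apply]
    have e0' : z x * (h x ^ 2 * u x) - K * (v x * w x) - Q x * h x ^ 2 * (v x * u x) = 0 := by
      field_simp at e0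
      linear_combination e0
    have : h x * (A' x * z x * (h x * u x) -
        v x * (r x * h x * u x + h x * (A x * w x))) = 0 := by
      linear_combination A' x * e0' - v x * w x * e5 + h x ^ 2 * v x * u x * e6
    exact (mul_eq_zero.mp this).resolve_left hx0.ne'

/-- A power series with bounded coefficients converges on the open unit interval. -/
lemma summable_mul_pow_of_bounded {c : ℕ → ℝ} {C : ℝ} (hc : ∀ n, |c n| ≤ C) {x : ℝ}
    (hx : |x| < 1) : Summable fun n => c n * x ^ n := by
  refine Summable.of_norm_bounded (g := fun n => C * |x| ^ n)
    ((summable_geometric_of_lt_one (abs_nonneg x) hx).mul_left C) fun n => ?_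
  rw [Real.norm_eq_abs, abs_mul, abs_pow]
  gcongr
  exact hc n

/-- The termwise differentiated series of a power series with bounded coefficients converges. -/
lemma summable_deriv_of_bounded {c : ℕ → ℝ} {C : ℝ} (hc : ∀ n, |c n| ≤ C) {x : ℝ}
    (hx : |x| < 1) : Summable fun n : ℕ => ((n : ℝ) + 1) * c (n + 1) * x ^ n := by
  have h1 : Summable fun n : ℕ => ((n : ℝ) + 1) * |x| ^ n := by
    have h := summable_pow_mul_geometric_of_norm_lt_one 1 (r := |x|) (by simpa using hx)
    have h' := summable_geometric_of_lt_one (abs_nonneg x) hx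
    refine (h.add h').congr fun n => ?_
    ring
  refine Summable.of_norm_bounded (g := fun n : ℕ => C * (((n : ℝ) + 1) * |x| ^ n))
    (h1.mul_left C) fun n => ?_
  have hn : |(n : ℝ) + 1| = n + 1 := abs_of_nonneg (by positivity)
  rw [Real.norm_eq_abs, abs_mul, abs_mul, abs_pow, hn]
  have := mul_le_mul_of_nonneg_right (hc (n + 1)) (by positivity : 0 ≤ ((n : ℝ) + 1) * |x| ^ n)
  linarith

/-- Termwise differentiation of a power series with bounded coefficients. -/
lemma hasDerivAt_tsum_of_bounded {c : ℕ → ℝ} {C : ℝ} (hc : ∀ n, |c n| ≤ C) {x : ℝ}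
    (hx : |x| < 1) :
    HasDerivAt (fun y => ∑' n, c n * y ^ n) (∑' n : ℕ, ((n : ℝ) + 1) * c (n + 1) * x ^ n) x := by
  obtain ⟨ρ, hxρ, hρ⟩ := exists_between hx
  have hρ0 : 0 ≤ ρ := (abs_nonneg x).trans hxρ.le
  have hρ1 : |ρ| < 1 := by rwa [abs_of_nonneg hρ0]
  have hb : Summable fun n : ℕ => C * ((n : ℝ) * ρ ^ (n - 1)) := by
    refine Summable.mul_left C ((summable_nat_add_iff 1).mp ?_)
    have := summable_deriv_of_bounded (c := fun _ => 1) (C := 1) (by simp) hρ1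
    simpa using this
  have key := hasDerivAt_tsum_of_isPreconnected (t := Metric.ball (0 : ℝ) ρ)
    (g := fun n y => c n * y ^ n) (g' := fun n y => c n * ((n : ℝ) * y ^ (n - 1)))
    hb Metric.isOpen_ball (convex_ball (0 : ℝ) ρ).isPreconnected
    (fun n y _ => (hasDerivAt_pow n y).const_mul (c n)) (fun n y hy => ?_)
    (y₀ := x) (by simpa using hxρ) (summable_mul_pow_of_bounded hc hx) (y := x)
    (by simpa using hxρ)
  · refine key.congr_deriv ?_
    have hs : Summable fun n : ℕ => c n * ((n : ℝ) * x ^ (n - 1)) := by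
      refine (summable_nat_add_iff 1).mp ?_
      refine (summable_deriv_of_bounded hc hx).congr fun n => ?_
      push_cast
      ring
    rw [hs.tsum_eq_zero_add]
    simp only [Nat.cast_zero, zero_mul, mul_zero, zero_add]
    refine tsum_congr fun n => ?_
    push_cast
    ring
  · have hy' : |y| ≤ ρ := by
      have : |y| < ρ := by simpa using hy
      exact this.le
    rw [Real.norm_eq_abs, abs_mul, abs_mul, abs_pow, Nat.abs_cast]
    have : (0 : ℝ) ≤ C := (abs_nonneg _).trans (hc 0)
    gcongr
    exact hc n

/-- The Taylor coefficients of `F(a, b; 1; x)`. -/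
noncomputable def hypCoeff (a b : ℝ) (n : ℕ) : ℝ :=
  (ascPochhammer ℝ n).eval a * (ascPochhammer ℝ n).eval b /
    ((ascPochhammer ℝ n).eval 1 * (Nat.factorial n))

lemma hypF_one_eq (a b x : ℝ) : hypF a b 1 x = ∑' n, hypCoeff a b n * x ^ n := rfl

lemma hypCoeff_zero (a b : ℝ) : hypCoeff a b 0 = 1 := by simp [hypCoeff]

lemma hypCoeff_succ (a b : ℝ) (n : ℕ) :
    ((n : ℝ) + 1) ^ 2 * hypCoeff a b (n + 1) = (a + n) * (b + n) * hypCoeff a b n := by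
  have h1 : (0 : ℝ) < (ascPochhammer ℝ n).eval 1 := ascPochhammer_pos n 1 one_pos
  have h2 : (0 : ℝ) < Nat.factorial n := by positivity
  simp only [hypCoeff, ascPochhammer_succ_eval, Nat.factorial_succ]
  push_cast
  field_simp
  ring

lemma hypCoeff_nonneg {a b : ℝ} (ha : 0 < a) (hb : 0 < b) (n : ℕ) : 0 ≤ hypCoeff a b n := by
  have h1 := ascPochhammer_pos n (1 : ℝ) one_pos
  have h2 := ascPochhammer_pos n a ha
  have h3 := ascPochhammer_pos n b hb
  unfold hypCoeff
  positivity

lemma hypCoeff_le_one {a b : ℝ} (ha : 0 < a) (hb : 0 < b) (hab : a + b = 1) (n : ℕ) :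
    hypCoeff a b n ≤ 1 := by
  induction n with
  | zero => rw [hypCoeff_zero]
  | succ n ih =>
    have h := hypCoeff_succ a b n
    have hn : (0 : ℝ) ≤ n := n.cast_nonneg
    have h0 := hypCoeff_nonneg ha hb n
    have h1 : (a + n) * (b + n) ≤ ((n : ℝ) + 1) ^ 2 := by
      have : (a + n) * (b + n) ≤ ((n : ℝ) + 1) * (n + 1) := by
        apply mul_le_mul <;> linarith
      linarith
    have h2 : (a + n) * (b + n) * hypCoeff a b n ≤ ((n : ℝ) + 1) ^ 2 * 1 := by
      apply mul_le_mul h1 ih h0 (by positivity)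
    rw [← h] at h2
    exact le_of_mul_le_mul_left h2 (by positivity)

lemma abs_hypCoeff_le_one {a b : ℝ} (ha : 0 < a) (hb : 0 < b) (hab : a + b = 1) (n : ℕ) :
    |hypCoeff a b n| ≤ 1 := by
  rw [abs_of_nonneg (hypCoeff_nonneg ha hb n)]
  exact hypCoeff_le_one ha hb hab n

lemma hypF_zero (a b : ℝ) : hypF a b 1 0 = 1 := by
  rw [hypF_one_eq, tsum_eq_single 0 (fun n hn => by simp [hn])]
  simp [hypCoeff_zero]

lemma hypF_pos {a b x : ℝ} (ha : 0 < a) (hb : 0 < b) (hab : a + b = 1) (hx0 : 0 ≤ x)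
    (hx1 : x < 1) : 0 < hypF a b 1 x := by
  have hs := summable_mul_pow_of_bounded (abs_hypCoeff_le_one ha hb hab)
    (show |x| < 1 by rwa [abs_of_nonneg hx0])
  rw [hypF_one_eq]
  refine hs.tsum_pos (fun n => mul_nonneg (hypCoeff_nonneg ha hb n) (pow_nonneg hx0 n)) 0 ?_
  simp [hypCoeff_zero]

/-- The quasi-derivative `x (1 - x) F'(x)` of `F(a, b; 1; x)`. -/
noncomputable def hypG (a b x : ℝ) : ℝ := x * (1 - x) * deriv (hypF a b 1) x

lemma hypG_zero (a b : ℝ) : hypG a b 0 = 0 := by simp [hypG]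

lemma hasDerivAt_hypF {a b x : ℝ} (ha : 0 < a) (hb : 0 < b) (hab : a + b = 1) (hx : |x| < 1) :
    HasDerivAt (hypF a b 1) (∑' n : ℕ, ((n : ℝ) + 1) * hypCoeff a b (n + 1) * x ^ n) x :=
  hasDerivAt_tsum_of_bounded (abs_hypCoeff_le_one ha hb hab) hx

/-- The Taylor coefficients of `hypG`. -/
noncomputable def hypGCoeff (a b : ℝ) : ℕ → ℝ
  | 0 => 0
  | n + 1 => a * b * hypCoeff a b n / (n + 1)

lemma hypG_eq_tsum {a b x : ℝ} (ha : 0 < a) (hb : 0 < b) (hab : a + b = 1) (hx : |x| < 1) :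
    hypG a b x = ∑' n, hypGCoeff a b n * x ^ n := by
  have hs := (summable_deriv_of_bounded (abs_hypCoeff_le_one ha hb hab) hx).hasSum
  rw [hypG, (hasDerivAt_hypF ha hb hab hx).deriv]
  set S := ∑' n : ℕ, ((n : ℝ) + 1) * hypCoeff a b (n + 1) * x ^ n
  have h1 : HasSum (fun n : ℕ => (n : ℝ) * hypCoeff a b n * x ^ n) (x * S) := by
    rw [← hasSum_nat_add_iff' 1]
    simp only [Finset.range_one, Finset.sum_singleton, Nat.cast_zero, zero_mul, sub_zero]
    refine (hs.mul_left x).congr_fun fun n => ?_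
    push_cast
    ring
  have h2 : HasSum (fun n => hypGCoeff a b n * x ^ n) (x * (1 - x) * S) := by
    rw [← hasSum_nat_add_iff' 1]
    simp only [Finset.range_one, Finset.sum_singleton, hypGCoeff, zero_mul, sub_zero]
    have h3 := (hs.mul_left x).sub (h1.mul_left x)
    rw [show x * (1 - x) * S = x * S - x * (x * S) by ring]
    refine h3.congr_fun fun n => ?_
    have hn : (n : ℝ) + 1 ≠ 0 := by positivity
    have hc := hypCoeff_succ a b n
    have hb' : b = 1 - a := by linarith
    field_simp
    subst hb'
    linear_combination (-x * x ^ n) * hc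
  exact h2.tsum_eq.symm

lemma hasDerivAt_hypG {a b x : ℝ} (ha : 0 < a) (hb : 0 < b) (hab : a + b = 1) (hx : |x| < 1) :
    HasDerivAt (hypG a b) (a * b * hypF a b 1 x) x := by
  have hbd : ∀ n, |hypGCoeff a b n| ≤ a * b := by
    rintro (_ | n)
    · simp only [hypGCoeff, abs_zero]; positivity
    · have h0 := hypCoeff_nonneg ha hb n
      have h1 := hypCoeff_le_one ha hb hab n
      have hn : (0 : ℝ) ≤ n := n.cast_nonneg
      rw [hypGCoeff, abs_of_nonneg (by positivity), div_le_iff₀ (by positivity)]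
      have : 0 ≤ a * b := by positivity
      gcongr
      linarith
  have h := hasDerivAt_tsum_of_bounded hbd hx
  have hev : hypG a b =ᶠ[nhds x] fun y => ∑' n, hypGCoeff a b n * y ^ n := by
    have : ∀ᶠ y in nhds x, |y| < 1 := continuous_abs.continuousAt.eventually_lt
      continuousAt_const hx
    filter_upwards [this] with y hy using hypG_eq_tsum ha hb hab hy
  refine (h.congr_of_eventuallyEq hev).congr_deriv ?_
  rw [hypF_one_eq, ← tsum_mul_left]
  refine tsum_congr fun n => ?_
  have hn : (n : ℝ) + 1 ≠ 0 := by positivity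
  rw [hypGCoeff]
  field_simp

lemma HasDerivAt.hypF_comp {a b y' p : ℝ} {y : ℝ → ℝ} (ha : 0 < a) (hb : 0 < b)
    (hab : a + b = 1) (hy : HasDerivAt y y' p) (hy0 : 0 < y p) (hy1 : y p < 1) :
    HasDerivAt (fun q => hypF a b 1 (y q)) (y' / (y p * (1 - y p)) * hypG a b (y p)) p := by
  have hx : |y p| < 1 := by rwa [abs_of_pos hy0]
  refine ((hasDerivAt_hypF ha hb hab hx).differentiableAt.hasDerivAt.comp p hy).congr_deriv ?_
  have : 1 - y p ≠ 0 := by linarith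
  rw [hypG]
  field_simp

lemma HasDerivAt.hypG_comp {a b y' p : ℝ} {y : ℝ → ℝ} (ha : 0 < a) (hb : 0 < b)
    (hab : a + b = 1) (hy : HasDerivAt y y' p) (hy0 : 0 < y p) (hy1 : y p < 1) :
    HasDerivAt (fun q => hypG a b (y q)) (a * b * y' * hypF a b 1 (y p)) p := by
  have hx : |y p| < 1 := by rwa [abs_of_pos hy0]
  refine ((hasDerivAt_hypG ha hb hab hx).comp p hy).congr_deriv ?_
  ring

open Set in
/-- A gauge relation between two pulled-back hypergeometric equations yields a hypergeometric
transformation formula. -/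
lemma hypF_transformation {a b c d : ℝ} (ha : 0 < a) (hb : 0 < b) (hab : a + b = 1)
    (hc : 0 < c) (hd : 0 < d) (hcd : c + d = 1) {x x' y y' h r P Q Q' : ℝ → ℝ} {K : ℝ}
    (hx : ∀ p ∈ Ico (0 : ℝ) 1, HasDerivAt x (x' p) p)
    (hy : ∀ p ∈ Ico (0 : ℝ) 1, HasDerivAt y (y' p) p)
    (hh : ∀ p ∈ Ico (0 : ℝ) 1, HasDerivAt h (r p * h p) p)
    (hQ : ∀ p ∈ Ico (0 : ℝ) 1, HasDerivAt Q (Q' p) p)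
    (x0 : x 0 = 0) (y0 : y 0 = 0) (h0 : h 0 = 1) (Q0 : Q 0 = 0)
    (hxI : ∀ p ∈ Ioo (0 : ℝ) 1, x p ∈ Ioo (0 : ℝ) 1)
    (hyI : ∀ p ∈ Ioo (0 : ℝ) 1, y p ∈ Ioo (0 : ℝ) 1)
    (hpos : ∀ p ∈ Ico (0 : ℝ) 1, 0 < h p)
    (hPy : ∀ p ∈ Ioo (0 : ℝ) 1, P p * (y' p / (y p * (1 - y p))) = 1)
    (hPx : ∀ p ∈ Ioo (0 : ℝ) 1, P p * h p ^ 2 * (x' p / (x p * (1 - x p))) = K)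
    (hPQ : ∀ p ∈ Ioo (0 : ℝ) 1, Q p = P p * r p)
    (hB : ∀ p ∈ Ioo (0 : ℝ) 1,
      (c * d * y' p - Q' p - Q p * r p) * h p ^ 2 = K * (a * b * x' p))
    {p : ℝ} (hp : p ∈ Ioo (0 : ℝ) 1) :
    hypF c d 1 (y p) = h p * hypF a b 1 (x p) := by
  have sub : Ioo (0 : ℝ) 1 ⊆ Ico 0 1 := Ioo_subset_Ico_self
  have hxI' : ∀ p ∈ Ico (0 : ℝ) 1, x p ∈ Ico (0 : ℝ) 1 := fun p hp => by
    rcases hp.1.eq_or_lt with rfl | h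
    · simp [x0]
    · exact sub (hxI p ⟨h, hp.2⟩)
  have hyI' : ∀ p ∈ Ico (0 : ℝ) 1, y p ∈ Ico (0 : ℝ) 1 := fun p hp => by
    rcases hp.1.eq_or_lt with rfl | h
    · simp [y0]
    · exact sub (hyI p ⟨h, hp.2⟩)
  have abs_lt : ∀ {t : ℝ}, t ∈ Ico (0 : ℝ) 1 → |t| < 1 := fun ht => by
    rw [abs_of_nonneg ht.1]; exact ht.2
  have cx : ContinuousOn x (Ico 0 1) := fun p hp => (hx p hp).continuousAt.continuousWithinAt
  have cy : ContinuousOn y (Ico 0 1) := fun p hp => (hy p hp).continuousAt.continuousWithinAt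
  have cF : ∀ {a b : ℝ}, 0 < a → 0 < b → a + b = 1 → ContinuousOn (hypF a b 1) (Ico 0 1) :=
    fun ha hb hab t ht => (hasDerivAt_hypF ha hb hab (abs_lt ht)).continuousAt.continuousWithinAt
  have cG : ∀ {a b : ℝ}, 0 < a → 0 < b → a + b = 1 → ContinuousOn (hypG a b) (Ico 0 1) :=
    fun ha hb hab t ht => (hasDerivAt_hypG ha hb hab (abs_lt ht)).continuousAt.continuousWithinAt
  have key := proportional_of_gauge
    (fun p hp => (hx p (sub hp)).hypF_comp ha hb hab (hxI p hp).1 (hxI p hp).2)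
    (fun p hp => (hx p (sub hp)).hypG_comp ha hb hab (hxI p hp).1 (hxI p hp).2)
    (fun p hp => (hy p (sub hp)).hypF_comp hc hd hcd (hyI p hp).1 (hyI p hp).2)
    (fun p hp => (hy p (sub hp)).hypG_comp hc hd hcd (hyI p hp).1 (hyI p hp).2)
    (fun p hp => hh p (sub hp)) (fun p hp => hQ p (sub hp)) hPy hPx hPQ hB
    ((cF ha hb hab).comp cx hxI') ((cG ha hb hab).comp cx hxI')
    ((cF hc hd hcd).comp cy hyI') ((cG hc hd hcd).comp cy hyI')
    (fun p hp => (hh p hp).continuousAt.continuousWithinAt)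
    (fun p hp => (hQ p hp).continuousAt.continuousWithinAt)
    (by rw [x0, hypG_zero]) (by rw [y0, hypG_zero]) Q0 hpos
    (fun p hp => hypF_pos ha hb hab (hxI' p hp).1 (hxI' p hp).2) hp
  have hu := hypF_pos ha hb hab (hxI' p (sub hp)).1 (hxI' p (sub hp)).2
  simp only [x0, y0, h0, hypF_zero, mul_one, div_one] at key
  rwa [div_eq_one_iff_eq (mul_pos (hpos p (sub hp)) hu).ne'] at key

lemma cubic_alpha_mem {p : ℝ} (hp : p ∈ Set.Ioo (0 : ℝ) 1) :
    p ^ 3 * (2 + p) / (1 + 2 * p) ∈ Set.Ioo (0 : ℝ) 1 := by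
  obtain ⟨h0, h1⟩ := hp
  refine ⟨by positivity, ?_⟩
  rw [div_lt_one (by positivity)]
  have : 0 < (1 + p) ^ 3 * (1 - p) := mul_pos (by positivity) (by linarith)
  linarith

lemma cubic_beta_mem {p : ℝ} (hp : p ∈ Set.Ioo (0 : ℝ) 1) :
    p * (2 + p) ^ 3 / (1 + 2 * p) ^ 3 ∈ Set.Ioo (0 : ℝ) 1 := by
  obtain ⟨h0, h1⟩ := hp
  refine ⟨by positivity, ?_⟩
  rw [div_lt_one (by positivity)]
  have : 0 < (1 - p) ^ 3 * (1 + p) := mul_pos (pow_pos (by linarith) 3) (by positivity)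
  linarith

lemma signature_three_mem {p : ℝ} (hp : p ∈ Set.Ioo (0 : ℝ) 1) :
    (27/4) * (p ^ 2 * (1 + p) ^ 2 / (1 + p + p ^ 2) ^ 3) ∈ Set.Ioo (0 : ℝ) 1 := by
  obtain ⟨h0, h1⟩ := hp
  refine ⟨by positivity, ?_⟩
  rw [← mul_div_assoc, div_lt_one (by positivity)]
  have : 0 < ((1 - p) * (1 + 2 * p) * (2 + p)) ^ 2 := by
    have : 0 < 1 - p := by linarith
    positivity
  linarith

lemma hasDerivAt_cubic_alpha {p : ℝ} (hp : 0 ≤ p) :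
    HasDerivAt (fun p : ℝ => p ^ 3 * (2 + p) / (1 + 2 * p))
      (6 * p ^ 2 * (1 + p) ^ 2 / (1 + 2 * p) ^ 2) p := by
  have i := hasDerivAt_id' p
  have hne : 1 + 2 * p ≠ 0 := by positivity
  refine (((i.fun_pow 3).fun_mul (i.const_add 2)).fun_div ((i.const_mul 2).const_add 1)
    hne).congr_deriv ?_
  field_simp
  push_cast
  ring

lemma hasDerivAt_cubic_beta {p : ℝ} (hp : 0 ≤ p) :
    HasDerivAt (fun p : ℝ => p * (2 + p) ^ 3 / (1 + 2 * p) ^ 3)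
      (2 * (2 + p) ^ 2 * (1 - p) ^ 2 / (1 + 2 * p) ^ 4) p := by
  have i := hasDerivAt_id' p
  have hne : 1 + 2 * p ≠ 0 := by positivity
  refine ((i.fun_mul ((i.const_add 2).fun_pow 3)).fun_div
    (((i.const_mul 2).const_add 1).fun_pow 3) (pow_ne_zero 3 hne)).congr_deriv ?_
  field_simp
  push_cast
  ring

lemma hasDerivAt_signature_three {p : ℝ} (hp : 0 ≤ p) :
    HasDerivAt (fun p : ℝ => (27/4) * (p ^ 2 * (1 + p) ^ 2 / (1 + p + p ^ 2) ^ 3))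
      ((27/4) * (p * (1 + p) * (1 + 2 * p) * (1 - p) * (2 + p) / (1 + p + p ^ 2) ^ 4)) p := by
  have i := hasDerivAt_id' p
  have hne : 1 + p + p ^ 2 ≠ 0 := by positivity
  refine ((((i.fun_pow 2).fun_mul ((i.const_add 1).fun_pow 2)).fun_div
    (((i.const_add 1).fun_add (i.fun_pow 2)).fun_pow 3)
    (pow_ne_zero 3 hne)).const_mul (27/4)).congr_deriv ?_
  field_simp
  push_cast
  ring

/-- The degree-three modular transformation of `F(1/2, 1/2; 1; ·)`. -/
lemma hypF_cubic_modular {p : ℝ} (hp : p ∈ Set.Ioo (0 : ℝ) 1) :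
    hypF (1/2) (1/2) 1 (p * (2 + p) ^ 3 / (1 + 2 * p) ^ 3) =
      (1 + 2 * p) * hypF (1/2) (1/2) 1 (p ^ 3 * (2 + p) / (1 + 2 * p)) := by
  refine hypF_transformation (K := 3)
    (x := fun p => p ^ 3 * (2 + p) / (1 + 2 * p))
    (y := fun p => p * (2 + p) ^ 3 / (1 + 2 * p) ^ 3) (h := fun p => 1 + 2 * p)
    (r := fun p => 2 / (1 + 2 * p))
    (P := fun p => p * (2 + p) * (1 - p) * (1 + p) / (2 * (1 + 2 * p) ^ 2))
    (Q := fun p => p * (2 + p) * (1 - p) * (1 + p) / (1 + 2 * p) ^ 3)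
    (Q' := fun p => (2 + 2 * p - 6 * p ^ 2 - 4 * p ^ 3) / (1 + 2 * p) ^ 3
      - 6 * (p * (2 + p) * (1 - p) * (1 + p)) / (1 + 2 * p) ^ 4)
    (by norm_num) (by norm_num) (by norm_num) (by norm_num) (by norm_num) (by norm_num)
    (fun p hp => hasDerivAt_cubic_alpha hp.1) (fun p hp => hasDerivAt_cubic_beta hp.1)
    ?_ ?_ (by norm_num) (by norm_num) (by norm_num) (by norm_num)
    (fun p hp => cubic_alpha_mem hp) (fun p hp => cubic_beta_mem hp)
    (fun p hp => by have := hp.1; positivity) ?_ ?_ ?_ ?_ hp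
  · intro p hp
    have h0 := hp.1
    refine (((hasDerivAt_id' p).const_mul 2).const_add 1).congr_deriv ?_
    field_simp
  · intro p hp
    have h0 := hp.1
    have i := hasDerivAt_id' p
    have hne : 1 + 2 * p ≠ 0 := by positivity
    refine ((((i.fun_mul (i.const_add 2)).fun_mul (i.const_sub 1)).fun_mul
      (i.const_add 1)).fun_div
      (((i.const_mul 2).const_add 1).fun_pow 3) (pow_ne_zero 3 hne)).congr_deriv ?_
    field_simp
    push_cast
    ring
  all_goals
    rintro p ⟨h0, h1⟩
    have h2 : 1 - p ≠ 0 := by linarith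
    have e1 : 1 - p ^ 3 * (2 + p) / (1 + 2 * p) = (1 + p) ^ 3 * (1 - p) / (1 + 2 * p) := by
      field_simp
      ring
    have e2 : 1 - p * (2 + p) ^ 3 / (1 + 2 * p) ^ 3 = (1 - p) ^ 3 * (1 + p) / (1 + 2 * p) ^ 3 := by
      field_simp
      ring
    try simp only [e1, e2]
    field_simp
  all_goals ring

/-- Passage from `F(1/2, 1/2; 1; ·)` to the signature-three function `F(1/3, 2/3; 1; ·)`. -/
lemma hypF_signature_three {p : ℝ} (hp : p ∈ Set.Ioo (0 : ℝ) 1) :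
    hypF (1/3) (2/3) 1 ((27/4) * (p ^ 2 * (1 + p) ^ 2 / (1 + p + p ^ 2) ^ 3)) =
      (1 + p + p ^ 2) / √(1 + 2 * p) *
        hypF (1/2) (1/2) 1 (p ^ 3 * (2 + p) / (1 + 2 * p)) := by
  refine hypF_transformation (K := 3 / 2)
    (x := fun p => p ^ 3 * (2 + p) / (1 + 2 * p))
    (y := fun p => (27/4) * (p ^ 2 * (1 + p) ^ 2 / (1 + p + p ^ 2) ^ 3))
    (h := fun p => (1 + p + p ^ 2) / √(1 + 2 * p))
    (r := fun p => 3 * p * (1 + p) / ((1 + p + p ^ 2) * (1 + 2 * p)))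
    (P := fun p => p * (1 + p) * (1 - p) * (1 + 2 * p) * (2 + p) / (4 * (1 + p + p ^ 2) ^ 2))
    (Q := fun p => 3 * (p ^ 2 * (1 + p) ^ 2 * ((1 - p) * (2 + p))) / (4 * (1 + p + p ^ 2) ^ 3))
    (Q' := fun p => 3 * ((2 * p * (1 + p) * (1 + 2 * p) * ((1 - p) * (2 + p))
        - p ^ 2 * (1 + p) ^ 2 * (1 + 2 * p)) / (4 * (1 + p + p ^ 2) ^ 3)
      - 3 * (1 + 2 * p) * (p ^ 2 * (1 + p) ^ 2 * ((1 - p) * (2 + p)))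
        / (4 * (1 + p + p ^ 2) ^ 4)))
    (by norm_num) (by norm_num) (by norm_num) (by norm_num) (by norm_num) (by norm_num)
    (fun p hp => hasDerivAt_cubic_alpha hp.1) (fun p hp => hasDerivAt_signature_three hp.1)
    ?_ ?_ (by norm_num) (by norm_num) (by norm_num) (by norm_num)
    (fun p hp => cubic_alpha_mem hp) (fun p hp => signature_three_mem hp)
    (fun p hp => by have := hp.1; positivity) ?_ ?_ ?_ ?_ hp
  · intro p hp
    have h0 := hp.1
    have i := hasDerivAt_id' p
    have hpos : 0 < 1 + 2 * p := by positivity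
    have hs : √(1 + 2 * p) ^ 2 = 1 + 2 * p := Real.sq_sqrt hpos.le
    have hs0 : √(1 + 2 * p) ≠ 0 := (Real.sqrt_pos.mpr hpos).ne'
    refine (((i.const_add 1).fun_add (i.fun_pow 2)).fun_div
      (((i.const_mul 2).const_add 1).sqrt hpos.ne') hs0).congr_deriv ?_
    field_simp
    rw [hs]
    push_cast
    ring
  · intro p hp
    have h0 := hp.1
    have i := hasDerivAt_id' p
    have hne : 1 + p + p ^ 2 ≠ 0 := by positivity
    refine (((((i.fun_pow 2).fun_mul ((i.const_add 1).fun_pow 2)).fun_mul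
      ((i.const_sub 1).fun_mul (i.const_add 2))).const_mul 3).fun_div
      ((((i.const_add 1).fun_add (i.fun_pow 2)).fun_pow 3).const_mul 4)
      (by positivity)).congr_deriv ?_
    field_simp
    push_cast
    ring
  all_goals
    rintro p ⟨h0, h1⟩
    have h2 : 1 - p ≠ 0 := by linarith
    have e1 : 1 - p ^ 3 * (2 + p) / (1 + 2 * p) = (1 + p) ^ 3 * (1 - p) / (1 + 2 * p) := by
      field_simp
      ring
    have e2 : 1 - (27/4) * (p ^ 2 * (1 + p) ^ 2 / (1 + p + p ^ 2) ^ 3) =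
        ((1 - p) * (1 + 2 * p) * (2 + p)) ^ 2 / (4 * (1 + p + p ^ 2) ^ 3) := by
      field_simp
      ring
    have hs : √(1 + 2 * p) ^ 2 = 1 + 2 * p := Real.sq_sqrt (by positivity)
    try simp only [e1, e2, div_pow, hs]
    field_simp
  all_goals ring

theorem bbg_corollary_5_8 (p : ℝ) (hp0 : 0 < p) (hp1 : p < 1) :
    hypF (1/2) (1/2) 1 (1 - p ^ 3 * (2 + p) / (1 + 2 * p)) /
        hypF (1/2) (1/2) 1 (p ^ 3 * (2 + p) / (1 + 2 * p)) =
      Real.sqrt 3 *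
        (hypF (1/3) (2/3) 1 (1 - (27/4) * (p ^ 2 * (1 + p) ^ 2 / (1 + p + p ^ 2) ^ 3)) /
          hypF (1/3) (2/3) 1 ((27/4) * (p ^ 2 * (1 + p) ^ 2 / (1 + p + p ^ 2) ^ 3))) := by
  have hp : p ∈ Set.Ioo (0 : ℝ) 1 := ⟨hp0, hp1⟩
  obtain ⟨q, hq⟩ : ∃ q, q = (1 - p) / (1 + 2 * p) := ⟨_, rfl⟩
  have hqI : q ∈ Set.Ioo (0 : ℝ) 1 := by
    rw [hq]
    refine ⟨div_pos (by linarith) (by positivity), ?_⟩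
    rw [div_lt_one (by positivity)]
    linarith
  have q1 : 1 + 2 * q = 3 / (1 + 2 * p) := by rw [hq]; field_simp; ring
  have q2 : 2 + q = 3 * (1 + p) / (1 + 2 * p) := by rw [hq]; field_simp; ring
  have q3 : 1 + q = (2 + p) / (1 + 2 * p) := by rw [hq]; field_simp; ring
  have q4 : 1 + q + q ^ 2 = 3 * (1 + p + p ^ 2) / (1 + 2 * p) ^ 2 := by
    rw [hq]; field_simp; ring
  have ea : q * (2 + q) ^ 3 / (1 + 2 * q) ^ 3 = 1 - p ^ 3 * (2 + p) / (1 + 2 * p) := by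
    rw [q1, q2, hq]
    field_simp
    ring
  have eb : (27/4) * (q ^ 2 * (1 + q) ^ 2 / (1 + q + q ^ 2) ^ 3) =
      1 - (27/4) * (p ^ 2 * (1 + p) ^ 2 / (1 + p + p ^ 2) ^ 3) := by
    rw [q4, q3, hq]
    field_simp
    ring
  have t1 := hypF_signature_three hp
  have t2 := hypF_signature_three hqI
  have t3 := hypF_cubic_modular hqI
  have hpos := hypF_pos (a := 1/2) (b := 1/2) (by norm_num) (by norm_num) (by norm_num)
    (cubic_alpha_mem hp).1.le (cubic_alpha_mem hp).2
  rw [ea] at t3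
  rw [eb] at t2
  rw [t1, t2, t3, q4, q1, Real.sqrt_div (by norm_num : (0 : ℝ) ≤ 3)]
  have hs : √(1 + 2 * p) ^ 2 = 1 + 2 * p := Real.sq_sqrt (by positivity)
  have hs0 : 0 < √(1 + 2 * p) := Real.sqrt_pos.mpr (by positivity)
  have h3 : 0 < √(3 : ℝ) := by positivity
  field_simp
  rw [hs]
  ring
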